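/- Let F be the free non-unital nonassociative ℚ-algebra on three generators x, y, z (the magma algebra over ℚ of the free magma on three generators), and let I be the two-sided ideal of F generated by all elements (ab)c + (ac)b − a(bc) − a(cb) with a, b, c ∈ F. Then in the quotient F/I, the ℚ-subspace spanned by the images of the twelve multilinear monomials in x, y, z (the six permutations of each of the two bracketings (uv)w and u(vw)) has dimension 9. -/

import Mathlib

/-- The smallest `R`-submodule of `F` containing `S` and closed under left and
right multiplication by arbitrary elements of `F`: the two-sided ideal of the
(possibly nonassociative, non-unital) algebra `F` generated by `S`, viewed as a
submodule. -/
def idealClosure (R F : Type*) [CommRing R] [AddCommGroup F] [Mul F] [Module R F]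
    (S : Set F) : Submodule R F :=
  sInf {p : Submodule R F | S ⊆ p ∧ ∀ a : F, ∀ x ∈ p, a * x ∈ p ∧ x * a ∈ p}

/-- The free non-unital nonassociative `ℚ`-algebra on three generators
(the magma algebra of the free magma on three generators). -/
abbrev FreeNA3 : Type := MonoidAlgebra ℚ (FreeMagma (Fin 3))

/-- The generators of `FreeNA3`. -/
noncomputable def ngen3 (i : Fin 3) : FreeNA3 :=
  MonoidAlgebra.single (FreeMagma.of i) 1

/-- The two-sided ideal of `FreeNA3` generated by the linearized
right-alternative relations. -/
noncomputable def raltIdeal3 : Submodule ℚ FreeNA3 :=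
  idealClosure ℚ FreeNA3
    {w | ∃ a b c : FreeNA3, w = (a*b)*c + (a*c)*b - a*(b*c) - a*(c*b)}

/-- The universal graded right-alternative algebra on three generators truncated above degree `3`,
with its degree `3` part restricted to the multilinear component. The coordinates of index
`(i, 0)`, `(i, 1)`, `(i, 2)` in degree `3` are dual to the monomials `xᵢ(xⱼxₖ)`, `xᵢ(xₖxⱼ)`,
`(xᵢxⱼ)xₖ`, where `j = i + 1` and `k = i + 2` modulo `3`. -/
def TruncRAlt : Type :=
  (Fin 3 → ℚ) × (Fin 3 → Fin 3 → ℚ) × (Fin 3 × Fin 3 → ℚ)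

namespace TruncRAlt

noncomputable instance : AddCommGroup TruncRAlt :=
  inferInstanceAs (AddCommGroup ((Fin 3 → ℚ) × (Fin 3 → Fin 3 → ℚ) × (Fin 3 × Fin 3 → ℚ)))

noncomputable instance : Module ℚ TruncRAlt :=
  inferInstanceAs (Module ℚ ((Fin 3 → ℚ) × (Fin 3 → Fin 3 → ℚ) × (Fin 3 × Fin 3 → ℚ)))

/-- The degree `1` component. -/
noncomputable def deg1 : TruncRAlt →ₗ[ℚ] (Fin 3 → ℚ) := LinearMap.fst ℚ _ _

/-- The degree `2` component. -/
noncomputable def deg2 : TruncRAlt →ₗ[ℚ] (Fin 3 → Fin 3 → ℚ) := LinearMap.fst ℚ _ _ ∘ₗ LinearMap.snd ℚ _ _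

/-- The multilinear degree `3` component. -/
noncomputable def deg3 : TruncRAlt →ₗ[ℚ] (Fin 3 × Fin 3 → ℚ) := LinearMap.snd ℚ _ _ ∘ₗ LinearMap.snd ℚ _ _

@[ext]
theorem ext {a b : TruncRAlt} (h1 : deg1 a = deg1 b) (h2 : deg2 a = deg2 b)
    (h3 : deg3 a = deg3 b) : a = b :=
  Prod.ext h1 (Prod.ext h2 h3)

noncomputable instance : Mul TruncRAlt where
  mul a b := (0, fun i j => deg1 a i * deg1 b j, fun p =>
    ![deg1 a p.1 * deg2 b (p.1 + 1) (p.1 + 2) + deg2 a p.1 (p.1 + 2) * deg1 b (p.1 + 1),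
      deg1 a p.1 * deg2 b (p.1 + 2) (p.1 + 1) + deg2 a p.1 (p.1 + 2) * deg1 b (p.1 + 1),
      deg2 a p.1 (p.1 + 1) * deg1 b (p.1 + 2) - deg2 a p.1 (p.1 + 2) * deg1 b (p.1 + 1)] p.2)

@[simp]
theorem deg1_mul (a b : TruncRAlt) : deg1 (a * b) = 0 := rfl

@[simp]
theorem deg2_mul (a b : TruncRAlt) (i j : Fin 3) :
    deg2 (a * b) i j = deg1 a i * deg1 b j := rfl

@[simp]
theorem deg3_mul_zero (a b : TruncRAlt) (i : Fin 3) : deg3 (a * b) (i, 0) =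
    deg1 a i * deg2 b (i + 1) (i + 2) + deg2 a i (i + 2) * deg1 b (i + 1) := rfl

@[simp]
theorem deg3_mul_one (a b : TruncRAlt) (i : Fin 3) : deg3 (a * b) (i, 1) =
    deg1 a i * deg2 b (i + 2) (i + 1) + deg2 a i (i + 2) * deg1 b (i + 1) := rfl

@[simp]
theorem deg3_mul_two (a b : TruncRAlt) (i : Fin 3) : deg3 (a * b) (i, 2) =
    deg2 a i (i + 1) * deg1 b (i + 2) - deg2 a i (i + 2) * deg1 b (i + 1) := rfl

theorem ext_coord {a b : TruncRAlt} (h1 : ∀ i, deg1 a i = deg1 b i)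
    (h2 : ∀ i j, deg2 a i j = deg2 b i j) (h30 : ∀ i, deg3 a (i, 0) = deg3 b (i, 0))
    (h31 : ∀ i, deg3 a (i, 1) = deg3 b (i, 1)) (h32 : ∀ i, deg3 a (i, 2) = deg3 b (i, 2)) :
    a = b := by
  refine ext (funext h1) (funext₂ h2) (funext fun p => ?_)
  obtain ⟨i, s⟩ := p
  fin_cases s
  exacts [h30 i, h31 i, h32 i]

noncomputable instance : NonUnitalNonAssocRing TruncRAlt where
  left_distrib a b c := by apply ext_coord <;> intros <;> simp <;> ring
  right_distrib a b c := by apply ext_coord <;> intros <;> simp <;> ring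
  zero_mul a := by apply ext_coord <;> intros <;> simp
  mul_zero a := by apply ext_coord <;> intros <;> simp

instance : IsScalarTower ℚ TruncRAlt TruncRAlt where
  smul_assoc r a b := by
    simp only [smul_eq_mul]
    apply ext_coord <;> intros <;> simp <;> ring

instance : SMulCommClass ℚ TruncRAlt TruncRAlt where
  smul_comm r a b := by
    simp only [smul_eq_mul]
    apply ext_coord <;> intros <;> simp <;> ring

theorem right_alternative (a b c : TruncRAlt) :
    (a * b) * c + (a * c) * b - a * (b * c) - a * (c * b) = 0 := by
  apply ext_coord <;> intros <;> simp <;> ring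

/-- The generators of `TruncRAlt`. -/
def gen (i : Fin 3) : TruncRAlt := (Pi.single i 1, 0, 0)

@[simp]
theorem deg1_gen (i : Fin 3) : deg1 (gen i) = Pi.single i 1 := rfl

@[simp]
theorem deg2_gen (i : Fin 3) : deg2 (gen i) = 0 := rfl

/-- The algebra homomorphism from the free algebra sending generators to generators. -/
noncomputable def ofFree : FreeNA3 →ₙₐ[ℚ] TruncRAlt :=
  MonoidAlgebra.liftMagma ℚ (FreeMagma.lift gen)

@[simp]
theorem ofFree_ngen3 (i : Fin 3) : ofFree (ngen3 i) = gen i := by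
  simp [ofFree, ngen3]

theorem raltIdeal3_le_ker : raltIdeal3 ≤ LinearMap.ker (ofFree : FreeNA3 →ₗ[ℚ] TruncRAlt) := by
  refine sInf_le ⟨?_, fun a x hx => ?_⟩
  · rintro _ ⟨a, b, c, rfl⟩
    simpa using right_alternative (ofFree a) (ofFree b) (ofFree c)
  · have hx' : ofFree x = 0 := hx
    simp [hx']

/-- The multilinear degree `3` component, as a map on the quotient by the ideal. -/
noncomputable def quotDeg3 : (FreeNA3 ⧸ raltIdeal3) →ₗ[ℚ] (Fin 3 × Fin 3 → ℚ) :=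
  deg3 ∘ₗ raltIdeal3.liftQ (ofFree : FreeNA3 →ₗ[ℚ] TruncRAlt) raltIdeal3_le_ker

theorem quotDeg3_mkQ (a : FreeNA3) : quotDeg3 (raltIdeal3.mkQ a) = deg3 (ofFree a) := rfl

end TruncRAlt

theorem subset_idealClosure (R F : Type*) [CommRing R] [AddCommGroup F] [Mul F] [Module R F]
    (S : Set F) : S ⊆ idealClosure R F S := fun _ hx =>
  Submodule.mem_sInf.2 fun _ hp => hp.1 hx

theorem mkQ_right_alternative (a b c : FreeNA3) :
    raltIdeal3.mkQ ((a * c) * b) = raltIdeal3.mkQ (a * (b * c)) + raltIdeal3.mkQ (a * (c * b)) -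
      raltIdeal3.mkQ ((a * b) * c) := by
  have h : raltIdeal3.mkQ ((a * b) * c + (a * c) * b - a * (b * c) - a * (c * b)) = 0 :=
    (Submodule.Quotient.mk_eq_zero _).2 (subset_idealClosure _ _ _ ⟨a, b, c, rfl⟩)
  simp only [map_add, map_sub] at h
  rw [← sub_eq_zero, ← h]
  abel

/-- Nine monomials whose images form a basis of the multilinear component. -/
noncomputable def basisMonomial (p : Fin 3 × Fin 3) : FreeNA3 :=
  ![ngen3 p.1 * (ngen3 (p.1 + 1) * ngen3 (p.1 + 2)),
    ngen3 p.1 * (ngen3 (p.1 + 2) * ngen3 (p.1 + 1)),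
    (ngen3 p.1 * ngen3 (p.1 + 1)) * ngen3 (p.1 + 2)] p.2

theorem quotDeg3_basisMonomial (p : Fin 3 × Fin 3) :
    TruncRAlt.quotDeg3 (raltIdeal3.mkQ (basisMonomial p)) = Pi.single p 1 := by
  rw [TruncRAlt.quotDeg3_mkQ]
  funext r
  obtain ⟨i, s⟩ := p
  obtain ⟨j, t⟩ := r
  fin_cases s <;> fin_cases t <;> fin_cases i <;> fin_cases j <;>
    simp [basisMonomial]

theorem linearIndependent_basisMonomial :
    LinearIndependent ℚ fun p => raltIdeal3.mkQ (basisMonomial p) := by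
  refine LinearIndependent.of_comp TruncRAlt.quotDeg3 ?_
  convert (Pi.basisFun ℚ (Fin 3 × Fin 3)).linearIndependent using 1
  funext p
  simpa using quotDeg3_basisMonomial p

/-- In the quotient of the free non-unital nonassociative `ℚ`-algebra on
`x, y, z` by the ideal generated by the linearized right-alternative identity,
the span of the images of the twelve multilinear monomials has dimension 9. -/
theorem ralt_arity_three_dimension :
    let x := ngen3 0
    let y := ngen3 1
    let z := ngen3 2
    let q := raltIdeal3.mkQ
    Module.finrank ℚ (Submodule.span ℚ
      ({q ((x*y)*z), q ((y*x)*z), q ((x*z)*y), q ((z*x)*y), q ((y*z)*x), q ((z*y)*x),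
        q (x*(y*z)), q (y*(x*z)), q (x*(z*y)), q (z*(x*y)), q (y*(z*x)), q (z*(y*x))} :
        Set (FreeNA3 ⧸ raltIdeal3))) = 9 := by
  intro x y z q
  have hspan := finrank_span_eq_card linearIndependent_basisMonomial
  rw [Fintype.card_prod, Fintype.card_fin] at hspan
  refine Eq.trans (congrArg (fun p : Submodule ℚ _ => Module.finrank ℚ p) ?_) hspan
  have hmem (p : Fin 3 × Fin 3) : q (basisMonomial p) ∈
      Submodule.span ℚ (Set.range fun p => raltIdeal3.mkQ (basisMonomial p)) :=
    Submodule.subset_span ⟨p, rfl⟩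
  have hmem' (i : Fin 3) : q ((ngen3 i * ngen3 (i + 2)) * ngen3 (i + 1)) ∈
      Submodule.span ℚ (Set.range fun p => raltIdeal3.mkQ (basisMonomial p)) := by
    simp only [q]
    rw [mkQ_right_alternative]
    exact sub_mem (add_mem (hmem (i, 0)) (hmem (i, 1))) (hmem (i, 2))
  apply le_antisymm <;> rw [Submodule.span_le]
  · simp only [Set.insert_subset_iff, Set.singleton_subset_iff]
    exact ⟨hmem (0, 2), hmem' 1, hmem' 0, hmem (2, 2), hmem (1, 2), hmem' 2,
      hmem (0, 0), hmem (1, 1), hmem (0, 1), hmem (2, 0), hmem (1, 0), hmem (2, 1)⟩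
  · rintro _ ⟨⟨i, s⟩, rfl⟩
    apply Submodule.subset_span
    fin_cases i <;> fin_cases s <;> simp [basisMonomial, x, y, z, q]
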